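/- arXiv:1109.4951 — 6 statements merged into one kernel-verified Lean document; each statement's English description precedes it below -/
import Mathlib

section
/- Let C ⊆ (0,∞) be an uncountable set. A continuous function f : ℝ → ℝ is vertically rigid for C if and only if f is of the form f(x) = a + b·x or f(x) = a + b·e^{k·x} for some a, b, k ∈ ℝ with k ≠ 0 (in the exponential case). -/
open Real Set

noncomputable section

/-- Euclidean plane. -/
abbrev E2 : Type := EuclideanSpace ℝ (Fin 2)

/-- The graph of a function f : ℝ → ℝ, as a subset of the Euclidean plane. -/
def graphOf1 (f : ℝ → ℝ) : Set E2 := {p | p 1 = f (p 0)}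

/-- The slopes of the chords of the graph of `f`. -/
def chordSlopes (f : ℝ → ℝ) : Set ℝ := {m | ∃ a b, a < b ∧ f b - f a = m * (b - a)}

/-- The cotangents of the angles between lines with slopes in `J`. -/
def cotangents (J : Set ℝ) : Set ℝ :=
  {k | ∃ m ∈ J, ∃ m' ∈ J, m < m' ∧ k = (1 + m * m') / (m' - m)}

theorem isPreconnected_chordSlopes {f : ℝ → ℝ} (hf : Continuous f) :
    IsPreconnected (chordSlopes f) := by
  have hconv : Convex ℝ {z : ℝ × ℝ | z.1 < z.2} := by
    intro z hz z' hz' a b ha hb hab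
    simp only [mem_ofPred_eq, Prod.fst_add, Prod.smul_fst, Prod.snd_add, Prod.smul_snd,
      smul_eq_mul] at *
    rcases ha.eq_or_lt with rfl | ha
    · have : b = 1 := by linarith
      subst this; linarith
    · nlinarith
  have himage : chordSlopes f =
      (fun z : ℝ × ℝ => (f z.2 - f z.1) / (z.2 - z.1)) '' {z : ℝ × ℝ | z.1 < z.2} := by
    ext m
    simp only [chordSlopes, mem_ofPred_eq, mem_image, Prod.exists]
    refine exists_congr fun a => exists_congr fun b => and_congr_right fun hab => ?_
    rw [div_eq_iff (by linarith)]
  rw [himage]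
  refine hconv.isPreconnected.image _ (ContinuousOn.div (by fun_prop) (by fun_prop) ?_)
  intro z hz
  have : z.1 < z.2 := hz
  linarith

theorem chordSlopes_const_mul {c : ℝ} (hc : c ≠ 0) (f : ℝ → ℝ) :
    chordSlopes (fun x => c * f x) = (fun m => c * m) '' chordSlopes f := by
  ext m
  constructor
  · rintro ⟨a, b, hab, h⟩
    refine ⟨m / c, ⟨a, b, hab, ?_⟩, by field_simp⟩
    field_simp
    linarith
  · rintro ⟨m, ⟨a, b, hab, h⟩, rfl⟩
    exact ⟨a, b, hab, by linear_combination c * h⟩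

theorem affine_of_subsingleton_chordSlopes {f : ℝ → ℝ} (h : (chordSlopes f).Subsingleton) :
    ∃ a b : ℝ, ∀ x : ℝ, f x = a + b * x := by
  have hmem : ∀ a b : ℝ, a < b → (f b - f a) / (b - a) ∈ chordSlopes f := fun a b hab =>
    ⟨a, b, hab, by rw [div_mul_cancel₀]; linarith⟩
  refine ⟨f 0, f 1 - f 0, fun x => ?_⟩
  have h01 := hmem 0 1 one_pos
  rcases lt_trichotomy x 0 with hx | rfl | hx
  · have := h (hmem x 0 hx) h01
    rw [div_eq_iff (by linarith)] at this
    simp at this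
    linarith
  · simp
  · have := h (hmem 0 x hx) h01
    rw [div_eq_iff (by linarith)] at this
    simp at this
    linarith

theorem isGLB_cotangents_of_isLUB {J : Set ℝ} {i s : ℝ} (hi : IsGLB J i) (hs : IsLUB J s)
    (hne : J.Nonempty) (his : i < s) :
    IsGLB (cotangents J) ((1 + i * s) / (s - i)) := by
  constructor
  · rintro k ⟨m, hm, m', hm', hlt, rfl⟩
    have h1 := hi.1 hm
    have h2 := hs.1 hm'
    rw [div_le_div_iff₀ (by linarith) (by linarith)]
    nlinarith [mul_nonneg (sub_nonneg.2 h1) (add_nonneg zero_le_one (sq_nonneg m')),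
      mul_nonneg (sub_nonneg.2 h2) (add_nonneg zero_le_one (sq_nonneg i)),
      mul_nonneg (sub_nonneg.2 h1) (sub_nonneg.2 h2),
      mul_nonneg (sub_nonneg.2 h2) (sub_nonneg.2 hlt.le),
      mul_nonneg (sub_nonneg.2 h1) (sub_nonneg.2 hlt.le)]
  · intro b hb
    obtain ⟨u, -, -, hu, huJ⟩ := hi.exists_seq_antitone_tendsto hne
    obtain ⟨v, -, -, hv, hvJ⟩ := hs.exists_seq_monotone_tendsto hne
    have hlim : Filter.Tendsto (fun n => (1 + u n * v n) / (v n - u n)) Filter.atTop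
        (nhds ((1 + i * s) / (s - i))) :=
      (tendsto_const_nhds.add (hu.mul hv)).div (hv.sub hu) (by linarith)
    refine ge_of_tendsto hlim ?_
    filter_upwards [hu.eventually_lt hv his] with n hn
    exact hb ⟨u n, huJ n, v n, hvJ n, hn, rfl⟩

theorem isGLB_cotangents_of_not_bddAbove {J : Set ℝ} {i : ℝ} (hi : IsGLB J i)
    (hJ : ¬ BddAbove J) : IsGLB (cotangents J) i := by
  constructor
  · rintro k ⟨m, hm, m', hm', hlt, rfl⟩
    have h1 := hi.1 hm
    rw [le_div_iff₀ (by linarith)]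
    nlinarith [mul_nonneg (sub_nonneg.2 h1) (sub_nonneg.2 hlt.le), sq_nonneg m]
  · intro b hb
    refine hi.2 fun m hm => ?_
    by_contra! hlt
    rw [not_bddAbove_iff] at hJ
    obtain ⟨m', hm', h⟩ := hJ (max m ((1 + b * m) / (b - m)))
    have h1 := (le_max_left _ _).trans_lt h
    have h2 := (le_max_right _ _).trans_lt h
    have h3 := hb ⟨m, hm, m', hm', h1, rfl⟩
    rw [le_div_iff₀ (by linarith)] at h3
    rw [div_lt_iff₀ (by linarith)] at h2
    linarith

theorem cotangents_neg (J : Set ℝ) : cotangents (-J) = cotangents J := by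
  have key : ∀ J : Set ℝ, cotangents (-J) ⊆ cotangents J := by
    rintro J k ⟨m, hm, m', hm', hlt, rfl⟩
    exact ⟨-m', hm', -m, hm, by linarith, by ring_nf⟩
  exact (key J).antisymm (by simpa using key (-J))

theorem isGLB_const_mul_image {c i : ℝ} (hc : 0 < c) {J : Set ℝ} (h : IsGLB J i) :
    IsGLB ((fun m => c * m) '' J) (c * i) :=
  (OrderIso.mulLeft₀ c hc).isGLB_image'.2 h

theorem isLUB_const_mul_image {c i : ℝ} (hc : 0 < c) {J : Set ℝ} (h : IsLUB J i) :
    IsLUB ((fun m => c * m) '' J) (c * i) :=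
  (OrderIso.mulLeft₀ c hc).isLUB_image'.2 h

theorem bddAbove_const_mul_image {c : ℝ} (hc : 0 < c) {J : Set ℝ} :
    BddAbove ((fun m => c * m) '' J) ↔ BddAbove J :=
  (OrderIso.mulLeft₀ c hc).bddAbove_image

theorem eq_zero_of_isGLB_of_cotangents_eq {J : Set ℝ} {c i : ℝ} (hc : 0 < c) (hc1 : c ≠ 1)
    (hi : IsGLB J i) (hJ : ¬ BddAbove J)
    (h : cotangents ((fun m => c * m) '' J) = cotangents J) : i = 0 := by
  have h1 := isGLB_cotangents_of_not_bddAbove (isGLB_const_mul_image hc hi)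
    (by rwa [bddAbove_const_mul_image hc])
  rw [h] at h1
  have h2 := h1.unique (isGLB_cotangents_of_not_bddAbove hi hJ)
  have h3 : (c - 1) * i = 0 := by linarith
  exact (mul_eq_zero.1 h3).resolve_left (sub_ne_zero.2 hc1)

/-- If uncountably many dilates of `J` have the same cotangents as `J`, then the endpoints of `J`
lie in `{0, ±∞}`. -/
theorem endpoints_of_cotangents_eq {J C : Set ℝ} (hJ : J.Nontrivial) (hC : C ⊆ Ioi 0)
    (hCu : ¬ C.Countable)
    (h : ∀ c ∈ C, cotangents ((fun m => c * m) '' J) = cotangents J) :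
    (¬ BddBelow J ∧ ¬ BddAbove J) ∨ (IsGLB J 0 ∧ ¬ BddAbove J) ∨ (IsLUB J 0 ∧ ¬ BddBelow J) := by
  obtain ⟨c, hcC, hc1⟩ : ∃ c ∈ C, c ≠ 1 := by
    by_contra! hall
    exact hCu ((countable_singleton (1 : ℝ)).mono hall)
  by_cases hb : BddBelow J <;> by_cases ha : BddAbove J
  · exfalso
    have hi := isGLB_csInf hJ.nonempty hb
    have hs := isLUB_csSup hJ.nonempty ha
    have his : sInf J < sSup J := by
      obtain ⟨m, hm, m', hm', hlt⟩ := hJ.exists_lt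
      exact (hi.1 hm).trans_lt (hlt.trans_le (hs.1 hm'))
    generalize sInf J = i at *
    generalize sSup J = s at *
    obtain ⟨k, hk⟩ : ∃ k, k = (1 + i * s) / (s - i) := ⟨_, rfl⟩
    have hk' := isGLB_cotangents_of_isLUB hi hs hJ.nonempty his
    rw [← hk] at hk'
    let P : Polynomial ℝ := .C 1 - .C (k * (s - i)) * .X + .C (i * s) * .X ^ 2
    have hP : P ≠ 0 := fun h0 => by simpa [P] using congrArg (Polynomial.eval 0) h0
    refine hCu (((P.roots.toFinset).finite_toSet.countable).mono fun c hc => ?_)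
    have hc0 : 0 < c := hC hc
    have h1 := isGLB_cotangents_of_isLUB (isGLB_const_mul_image hc0 hi)
      (isLUB_const_mul_image hc0 hs) (hJ.nonempty.image _) (mul_lt_mul_of_pos_left his hc0)
    rw [h c hc] at h1
    have h2 := h1.unique hk'
    rw [div_eq_iff (by nlinarith)] at h2
    simp only [Finset.mem_coe, Multiset.mem_toFinset, Polynomial.mem_roots hP,
      Polynomial.IsRoot.def]
    simp [P]
    linarith
  · have hi := isGLB_csInf hJ.nonempty hb
    rw [eq_zero_of_isGLB_of_cotangents_eq (hC hcC) hc1 hi ha (h c hcC)] at hi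
    exact .inr (.inl ⟨hi, ha⟩)
  · have hs := isLUB_csSup hJ.nonempty ha
    have hi : IsGLB (-J) (-sSup J) := hs.neg
    have hneg : (fun m => c * m) '' (-J) = -((fun m => c * m) '' J) := by
      ext x
      simp only [mem_image, Set.mem_neg]
      constructor
      · rintro ⟨y, hy, rfl⟩
        exact ⟨-y, hy, by ring⟩
      · rintro ⟨y, hy, hxy⟩
        exact ⟨-y, by simpa using hy, by linarith⟩
    have h0 := eq_zero_of_isGLB_of_cotangents_eq (hC hcC) hc1 hi (by simpa using hb)
      (by rw [hneg, cotangents_neg, cotangents_neg, h c hcC])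
    rw [neg_eq_zero.1 h0] at hs
    exact .inr (.inr ⟨hs, hb⟩)
  · exact .inl ⟨hb, ha⟩

/-- The matrix `!![p, r; q, w]` is orthogonal. -/
structure IsOrthogonalEntries (p q r w : ℝ) : Prop where
  left_sq : p ^ 2 + q ^ 2 = 1
  right_sq : r ^ 2 + w ^ 2 = 1
  dot : p * r + q * w = 0

/-- The matrix `!![p, r; q, w]` maps lines with slopes in `J` to lines with slopes in `J'`. -/
def MapsSlopes (p q r w : ℝ) (J J' : Set ℝ) : Prop :=
  ∀ m ∈ J, p + r * m ≠ 0 ∧ (q + w * m) / (p + r * m) ∈ J'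

theorem cotangents_subset_of_mapsSlopes {p q r w : ℝ} (ho : IsOrthogonalEntries p q r w)
    {J J' : Set ℝ} (hJ : IsPreconnected J) (h : MapsSlopes p q r w J J') :
    cotangents J ⊆ cotangents J' := by
  obtain ⟨h1, h2, h3⟩ := ho
  rintro k ⟨m, hm, m', hm', hlt, rfl⟩
  obtain ⟨hn, hM⟩ := h m hm
  obtain ⟨hn', hM'⟩ := h m' hm'
  have hpos : 0 < (p + r * m) * (p + r * m') := by
    by_contra! hle
    have hJo := hJ.image (fun m => p + r * m) (by fun_prop)
    have hoc := hJo.ordConnected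
    have hz : (0 : ℝ) ∈ (fun m => p + r * m) '' J := by
      rcases lt_or_gt_of_ne hn with hneg | hpos
      · exact hoc.out ⟨m, hm, rfl⟩ ⟨m', hm', rfl⟩ ⟨hneg.le, by nlinarith⟩
      · exact hoc.out ⟨m', hm', rfl⟩ ⟨m, hm, rfl⟩ ⟨by nlinarith, hpos.le⟩
    obtain ⟨x, hx, hx0⟩ := hz
    exact (h x hx).1 hx0
  have hdet : (p * w - q * r) ^ 2 = 1 := by
    linear_combination (r ^ 2 + w ^ 2) * h1 + h2 - (p * r + q * w) * h3
  set M := (q + w * m) / (p + r * m) with hMdef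
  set M' := (q + w * m') / (p + r * m') with hMdef'
  have hdot : (p + r * m) * (p + r * m') * (1 + M * M') = 1 + m * m' := by
    have : (p + r * m) * (p + r * m') * (1 + M * M') =
        (p + r * m) * (p + r * m') + (q + w * m) * (q + w * m') := by
      rw [hMdef, hMdef']; field_simp
    rw [this]
    linear_combination h1 + (m + m') * h3 + m * m' * h2
  have hcross : (p + r * m) * (p + r * m') * (M' - M) = (p * w - q * r) * (m' - m) := by
    rw [hMdef, hMdef']; field_simp; ring
  rcases mul_self_eq_one_iff.1 ((sq _).symm.trans hdet) with hd | hd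
  · have hMM : M < M' := by
      rw [hd] at hcross
      by_contra! hle
      nlinarith
    refine ⟨M, hM, M', hM', hMM, ?_⟩
    rw [div_eq_div_iff (by linarith) (by linarith), ← hdot]
    rw [hd] at hcross
    linear_combination (1 + M * M') * hcross
  · have hMM : M' < M := by
      rw [hd] at hcross
      by_contra! hle
      nlinarith
    refine ⟨M', hM', M, hM, hMM, ?_⟩
    rw [div_eq_div_iff (by linarith) (by linarith), ← hdot]
    rw [hd] at hcross
    linear_combination -(1 + M * M') * hcross

theorem eq_zero_of_quadratic_nonneg {J : Set ℝ} (hi : IsGLB J 0) (hJ : ¬ BddAbove J) {a b : ℝ}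
    (h : ∀ m ∈ J, 0 ≤ a * (1 - m ^ 2) + b * m) : a = 0 := by
  have hb : b ≤ |b| := le_abs_self b
  have hb0 : 0 < |b| + 1 := by positivity
  rcases lt_trichotomy a 0 with ha | ha | ha
  · exfalso
    obtain ⟨m, hm, hm0, hlt⟩ := hi.exists_between
      (show 0 < min (1 / 2) (-a / (4 * (|b| + 1))) from lt_min (by norm_num)
        (div_pos (by linarith) (by linarith)))
    have h1 := hlt.trans_le (min_le_left _ _)
    have h2 := hlt.trans_le (min_le_right _ _)
    rw [lt_div_iff₀ (by linarith)] at h2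
    have h3 : m ^ 2 ≤ 1 / 4 := by nlinarith
    have h4 : b * m ≤ (|b| + 1) * m := mul_le_mul_of_nonneg_right (by linarith) hm0
    have h5 : a * (1 - m ^ 2) ≤ a * (3 / 4) := mul_le_mul_of_nonpos_left (by linarith) ha.le
    linarith [h m hm]
  · exact ha
  · exfalso
    obtain ⟨m, hm, hlt⟩ := not_bddAbove_iff.1 hJ (max 2 (2 * (|b| + 1) / a))
    have h1 := (le_max_left _ _).trans_lt hlt
    have h2 := (le_max_right _ _).trans_lt hlt
    rw [div_lt_iff₀ ha] at h2
    have h3 : b * m ≤ (|b| + 1) * m := mul_le_mul_of_nonneg_right (by linarith) (by linarith)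
    have h4 : 4 < m ^ 2 := by nlinarith
    have h5 : 2 * (|b| + 1) * m ≤ m * a * m := mul_le_mul_of_nonneg_right h2.le (by linarith)
    nlinarith [h m hm, mul_lt_mul_of_pos_left h4 ha]

theorem mul_eq_zero_of_mapsSlopes {p q r w c : ℝ} (ho : IsOrthogonalEntries p q r w)
    {J : Set ℝ} (hc : 0 < c) (hJ : IsPreconnected J)
    (h : MapsSlopes p q r w J ((fun m => c * m) '' J))
    (hend : (¬ BddBelow J ∧ ¬ BddAbove J) ∨ (IsGLB J 0 ∧ ¬ BddAbove J) ∨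
      (IsLUB J 0 ∧ ¬ BddBelow J)) : p * q = 0 := by
  obtain ⟨h1, h2, h3⟩ := ho
  have hdet : (p * w - q * r) ^ 2 = 1 := by
    linear_combination (r ^ 2 + w ^ 2) * h1 + h2 - (p * r + q * w) * h3
  have hw : w = (p * w - q * r) * p := by linear_combination q * h3 - w * h1
  have hr : r = -((p * w - q * r) * q) := by linear_combination p * h3 - r * h1
  have hrw : r * w = -(p * q) := by
    calc r * w = -((p * w - q * r) * q) * ((p * w - q * r) * p) := by rw [← hr, ← hw]
      _ = -(p * q) := by linear_combination -(p * q) * hdet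
  have hquad : ∀ m, (q + w * m) * (p + r * m) = p * q * (1 - m ^ 2) + (p * w + q * r) * m :=
    fun m => by linear_combination m ^ 2 * hrw
  have hsign : ∀ m ∈ J, ∃ n ∈ J,
      p * q * (1 - m ^ 2) + (p * w + q * r) * m = n * (c * (p + r * m) ^ 2) := by
    intro m hm
    obtain ⟨hn, n, hnJ, hnm⟩ := h m hm
    refine ⟨n, hnJ, ?_⟩
    have : c * n = (q + w * m) / (p + r * m) := hnm
    rw [eq_div_iff hn] at this
    rw [← hquad, ← this]
    ring
  rcases hend with ⟨hb, ha⟩ | ⟨hi, ha⟩ | ⟨hs, hb⟩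
  · have hr0 : r = 0 := by
      by_contra hr0
      obtain ⟨m, hm, hlt⟩ := not_bddBelow_iff.1 hb (-p / r)
      obtain ⟨m', hm', hlt'⟩ := not_bddAbove_iff.1 ha (-p / r)
      refine (h _ (hJ.ordConnected.out hm hm' ⟨hlt.le, hlt'.le⟩)).1 ?_
      field_simp
      ring
    have hpq : p * q = -(r * w) := by linarith
    rw [hpq, hr0]
    ring
  · refine eq_zero_of_quadratic_nonneg hi ha (b := p * w + q * r) fun m hm => ?_
    obtain ⟨n, hn, hnm⟩ := hsign m hm
    rw [hnm]
    exact mul_nonneg (hi.1 hn) (by positivity)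
  · have hi : IsGLB (-J) 0 := by simpa using hs.neg
    refine neg_eq_zero.1 (eq_zero_of_quadratic_nonneg hi (by simpa using hb)
      (b := p * w + q * r) fun m hm => ?_)
    obtain ⟨n, hn, hnm⟩ := hsign (-m) hm
    have : n * (c * (p + r * -m) ^ 2) ≤ 0 :=
      mul_nonpos_of_nonpos_of_nonneg (hs.1 hn) (by positivity)
    linarith

theorem mapsSlopes_chordSlopes {p q r w s t : ℝ} (ho : IsOrthogonalEntries p q r w)
    {f g : ℝ → ℝ} (h : ∀ x, g (p * x + r * f x + s) = q * x + w * f x + t) :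
    MapsSlopes p q r w (chordSlopes f) (chordSlopes g) := by
  obtain ⟨h1, h2, h3⟩ := ho
  rintro m ⟨a, b, hab, hm⟩
  have ha := h a
  have hb := h b
  have hX : (p * b + r * f b + s) - (p * a + r * f a + s) = (p + r * m) * (b - a) := by
    linear_combination r * hm
  have hY : g (p * b + r * f b + s) - g (p * a + r * f a + s) = (q + w * m) * (b - a) := by
    rw [ha, hb]
    linear_combination w * hm
  generalize p * b + r * f b + s = B at *
  generalize p * a + r * f a + s = A at *
  have hab0 : b - a ≠ 0 := by linarith
  have hn : p + r * m ≠ 0 := by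
    intro h0
    have hBA : B = A := by rw [h0, zero_mul] at hX; linarith
    rw [hBA, sub_self] at hY
    have h0' : q + w * m = 0 := (mul_eq_zero.1 hY.symm).resolve_right hab0
    have : 1 + m ^ 2 = 0 := by
      linear_combination (p + r * m) * h0 + (q + w * m) * h0' - h1 - m ^ 2 * h2 - 2 * m * h3
    nlinarith [sq_nonneg m]
  refine ⟨hn, ?_⟩
  have hBA : B - A ≠ 0 := by rw [hX]; exact mul_ne_zero hn hab0
  rcases lt_or_gt_of_ne hBA with hlt | hlt
  · refine ⟨B, A, by linarith, ?_⟩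
    rw [div_mul_eq_mul_div, eq_div_iff hn]
    linear_combination (q + w * m) * hX - (p + r * m) * hY
  · refine ⟨A, B, by linarith, ?_⟩
    rw [div_mul_eq_mul_div, eq_div_iff hn]
    linear_combination -(q + w * m) * hX + (p + r * m) * hY

theorem exists_entries_of_isometry (φ : E2 ≃ᵢ E2) {f g : ℝ → ℝ}
    (h : φ '' graphOf1 f = graphOf1 g) :
    ∃ p q r w s t, IsOrthogonalEntries p q r w ∧
      (∀ x, g (p * x + r * f x + s) = q * x + w * f x + t) ∧
      ∀ X, ∃ x, X = p * x + r * f x + s := by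
  let L := φ.toRealAffineIsometryEquiv.linearIsometryEquiv
  have hφ : ∀ v, φ v = L v + φ 0 := fun v => by
    simpa using φ.toRealAffineIsometryEquiv.map_vadd 0 v
  have hL : ∀ v : E2, L v = v 0 • L !₂[1, 0] + v 1 • L !₂[0, 1] := fun v => by
    rw [← map_smul, ← map_smul, ← map_add]
    congr 1
    ext i
    fin_cases i <;> simp
  have h00 := L.inner_map_map !₂[1, 0] !₂[1, 0]
  have h11 := L.inner_map_map !₂[0, 1] !₂[0, 1]
  have h01 := L.inner_map_map !₂[1, 0] !₂[0, 1]
  simp only [PiLp.inner_apply, Fin.sum_univ_two] at h00 h11 h01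
  norm_num at h00 h11 h01
  have hcoord : ∀ (v : E2) (i : Fin 2),
      φ v i = (L !₂[1, 0]) i * v 0 + (L !₂[0, 1]) i * v 1 + φ 0 i := fun v i => by
    rw [hφ, hL]
    simp [mul_comm]
  refine ⟨L !₂[1, 0] 0, L !₂[1, 0] 1, L !₂[0, 1] 0, L !₂[0, 1] 1, φ 0 0, φ 0 1,
    ⟨by linarith, by linarith, by linarith⟩, fun x => ?_, fun X => ?_⟩
  · have hmem : φ !₂[x, f x] ∈ graphOf1 g := h ▸ mem_image_of_mem _ (by simp [graphOf1])
    have := hmem.symm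
    rw [hcoord _ 0, hcoord _ 1] at this
    simpa using this
  · have hmem : (!₂[X, g X] : E2) ∈ φ '' graphOf1 f := by rw [h]; simp [graphOf1]
    obtain ⟨v, hv, hvX⟩ := hmem
    refine ⟨v 0, ?_⟩
    have hv1 : v 1 = f (v 0) := hv
    rw [← hv1, ← hcoord, hvX]
    simp

/-- Entries of an orthogonal matrix whose first column has a zero entry. -/
theorem IsOrthogonalEntries.mem_of_mul_eq_zero {p q r w : ℝ} (ho : IsOrthogonalEntries p q r w)
    (h : p * q = 0) :
    (p, q, r, w) ∈
      ({0, 1, -1} ×ˢ {0, 1, -1} ×ˢ {0, 1, -1} ×ˢ {0, 1, -1} : Set (ℝ × ℝ × ℝ × ℝ)) := by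
  obtain ⟨h1, h2, h3⟩ := ho
  simp only [mem_prod, mem_insert_iff, mem_singleton_iff]
  rcases mul_eq_zero.1 h with rfl | rfl
  · have hq : q = 1 ∨ q = -1 := by
      rw [← mul_self_eq_one_iff]; linarith
    have hw : w = 0 := by
      rcases hq with rfl | rfl <;> linarith
    subst hw
    have hr : r = 1 ∨ r = -1 := by
      rw [← mul_self_eq_one_iff]; linarith
    tauto
  · have hp : p = 1 ∨ p = -1 := by
      rw [← mul_self_eq_one_iff]; linarith
    have hr : r = 0 := by
      rcases hp with rfl | rfl <;> linarith
    subst hr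
    have hw : w = 1 ∨ w = -1 := by
      rw [← mul_self_eq_one_iff]; linarith
    tauto

/-- Translations under which `f` changes by an affine bijection of the line. -/
def affineTranslations (f : ℝ → ℝ) : AddSubgroup ℝ where
  carrier := {u | ∃ c d : ℝ, c ≠ 0 ∧ ∀ x, f (x + u) = c * f x + d}
  zero_mem' := ⟨1, 0, one_ne_zero, fun x => by simp⟩
  add_mem' := by
    rintro u v ⟨c, d, hc, h⟩ ⟨c', d', hc', h'⟩
    refine ⟨c' * c, c' * d + d', mul_ne_zero hc' hc, fun x => ?_⟩
    rw [← add_assoc, h', h]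
    ring
  neg_mem' := by
    rintro u ⟨c, d, hc, h⟩
    refine ⟨c⁻¹, -(c⁻¹ * d), inv_ne_zero hc, fun x => ?_⟩
    have := h (x + -u)
    rw [neg_add_cancel_right] at this
    rw [this]
    field_simp
    ring

theorem affine_of_add_sub {f : ℝ → ℝ} (hf : Continuous f)
    (h : ∀ x u, f (x + u) - f u = f x - f 0) : ∃ a b : ℝ, ∀ x : ℝ, f x = a + b * x := by
  let g : ℝ →+ ℝ := AddMonoidHom.mk' (fun x => f x - f 0) fun x u => by
    linear_combination h x u
  refine ⟨f 0, f 1 - f 0, fun x => ?_⟩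
  have := map_real_smul g (by show Continuous fun x => f x - f 0; fun_prop) x 1
  simp [g] at this
  linarith

theorem affine_or_exp_of_dense {f : ℝ → ℝ} (hf : Continuous f) {x₀ y₀ : ℝ} (hne : f x₀ ≠ f y₀)
    (hd : Dense (affineTranslations f : Set ℝ)) :
    (∃ a b : ℝ, ∀ x : ℝ, f x = a + b * x) ∨
     (∃ a b k : ℝ, k ≠ 0 ∧ ∀ x : ℝ, f x = a + b * Real.exp (k * x)) := by
  have hne' := sub_ne_zero.2 hne
  have hident : ∀ u x,
      (f (x + u) - f (y₀ + u)) * (f x₀ - f y₀) = (f (x₀ + u) - f (y₀ + u)) * (f x - f y₀) := by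
    intro u x
    have hcl : IsClosed {u | (f (x + u) - f (y₀ + u)) * (f x₀ - f y₀) =
        (f (x₀ + u) - f (y₀ + u)) * (f x - f y₀)} := isClosed_eq (by fun_prop) (by fun_prop)
    refine hcl.closure_subset_iff.2 ?_ (hd u)
    rintro u ⟨c, d, -, h⟩
    simp only [mem_ofPred_eq, h]
    ring
  let c : ℝ → ℝ := fun u => (f (x₀ + u) - f (y₀ + u)) / (f x₀ - f y₀)
  have hc : ∀ x y u, f (x + u) - f (y + u) = c u * (f x - f y) := by
    intro x y u
    simp only [c]
    rw [div_mul_eq_mul_div, eq_div_iff hne']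
    linear_combination hident u x - hident u y
  have hc0 : c 0 = 1 := by simp [c, hne']
  have hcadd : ∀ u v, c (u + v) = c u * c v := by
    intro u v
    have h1 := hc (x₀ + u) (y₀ + u) v
    rw [hc x₀ y₀ u, add_assoc, add_assoc, hc] at h1
    apply mul_right_cancel₀ hne'
    linear_combination h1
  have hcne : ∀ u, c u ≠ 0 := by
    intro u h0
    have := hcadd u (-u)
    rw [h0, add_neg_cancel, hc0] at this
    simp at this
  have hcpos : ∀ u, 0 < c u := by
    intro u
    rw [← add_halves u, hcadd]
    exact mul_self_pos.2 (hcne _)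
  have hccont : Continuous c := by fun_prop
  let g : ℝ →+ ℝ := AddMonoidHom.mk' (fun u => Real.log (c u)) fun u v => by
    rw [hcadd, Real.log_mul (hcne _) (hcne _)]
  obtain ⟨k, hk⟩ : ∃ k, k = Real.log (c 1) := ⟨_, rfl⟩
  have hexp : ∀ u, c u = Real.exp (k * u) := by
    intro u
    have := map_real_smul g (hccont.log hcne) u 1
    simp [g] at this
    rw [hk, mul_comm, ← this, Real.exp_log (hcpos u)]
  have hmain : ∀ x u, f (x + u) - f u = Real.exp (k * u) * (f x - f 0) := by
    intro x u
    have := hc x 0 u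
    rwa [zero_add, hexp] at this
  rcases eq_or_ne k 0 with h0 | h0
  · left
    exact affine_of_add_sub hf fun x u => by simpa [h0] using hmain x u
  · right
    have hk1 : Real.exp k - 1 ≠ 0 := by
      rw [sub_ne_zero, Ne, Real.exp_eq_one_iff]
      exact h0
    refine ⟨f 0 - (f 1 - f 0) / (Real.exp k - 1), (f 1 - f 0) / (Real.exp k - 1), k, h0,
      fun x => ?_⟩
    have h1 := hmain x 1
    have h2 := hmain 1 x
    rw [add_comm 1 x] at h2
    rw [mul_one] at h1
    field_simp
    linear_combination h2 - h1

theorem affine_or_exp_of_translations {f : ℝ → ℝ} (hf : Continuous f) {C : Set ℝ}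
    (hC : C ⊆ Ioi 0) (hCu : ¬ C.Countable) {c₁ : ℝ} (hc₁ : c₁ ≠ 0)
    (h : ∀ c ∈ C, ∃ u v : ℝ, ∀ x, c * f (x + u) = c₁ * f x + v) :
    (∃ a b : ℝ, ∀ x : ℝ, f x = a + b * x) ∨
     (∃ a b k : ℝ, k ≠ 0 ∧ ∀ x : ℝ, f x = a + b * Real.exp (k * x)) := by
  by_cases hconst : ∀ x, f x = f 0
  · exact .inl ⟨f 0, 0, fun x => by rw [hconst x]; ring⟩
  push Not at hconst
  obtain ⟨x₀, hx₀⟩ := hconst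
  choose! u v huv using h
  have hmaps : MapsTo u C (affineTranslations f) := fun c hc => by
    have hc0 : c ≠ 0 := (hC hc).ne'
    refine ⟨c₁ / c, v c / c, div_ne_zero hc₁ hc0, fun x => ?_⟩
    have := huv c hc x
    field_simp
    linarith
  have hinj : InjOn u C := fun c hc c' hc' heq => by
    have h1 := huv c hc (x₀ - u c)
    have h2 := huv c hc (0 - u c)
    have h3 := huv c' hc' (x₀ - u c)
    have h4 := huv c' hc' (0 - u c)
    rw [← heq] at h3 h4
    simp only [sub_add_cancel] at h1 h2 h3 h4
    exact mul_right_cancel₀ (sub_ne_zero.2 hx₀) (by linarith)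
  have hG : ¬ (affineTranslations f : Set ℝ).Countable := fun hcount =>
    hCu (hmaps.countable_of_injOn hinj hcount)
  refine affine_or_exp_of_dense hf hx₀ ?_
  rcases AddSubgroup.dense_or_cyclic (affineTranslations f) with hd | ⟨a, ha⟩
  · exact hd
  · refine absurd ?_ hG
    rw [ha, ← AddSubgroup.zmultiples_eq_closure, AddSubgroup.coe_zmultiples]
    exact countable_range _

theorem affine_or_exp_of_rigid {f : ℝ → ℝ} (hf : Continuous f) {C : Set ℝ}
    (hC : C ⊆ Ioi 0) (hCu : ¬ C.Countable)
    (h : ∀ c ∈ C, ∃ φ : E2 ≃ᵢ E2, φ '' graphOf1 f = graphOf1 (fun x => c * f x)) :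
    (∃ a b : ℝ, ∀ x : ℝ, f x = a + b * x) ∨
     (∃ a b k : ℝ, k ≠ 0 ∧ ∀ x : ℝ, f x = a + b * Real.exp (k * x)) := by
  rcases (chordSlopes f).subsingleton_or_nontrivial with hsub | hnon
  · exact .inl (affine_of_subsingleton_chordSlopes hsub)
  have hcot : ∀ (φ : E2 ≃ᵢ E2) (f g : ℝ → ℝ), Continuous f → φ '' graphOf1 f = graphOf1 g →
      cotangents (chordSlopes f) ⊆ cotangents (chordSlopes g) := by
    intro φ f g hf hφ
    obtain ⟨p, q, r, w, s, t, ho, hfg, -⟩ := exists_entries_of_isometry φ hφ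
    exact cotangents_subset_of_mapsSlopes ho (isPreconnected_chordSlopes hf)
      (mapsSlopes_chordSlopes ho hfg)
  have hend := endpoints_of_cotangents_eq hnon hC hCu fun c hc => by
    obtain ⟨φ, hφ⟩ := h c hc
    rw [← chordSlopes_const_mul (ne_of_gt (hC hc))]
    refine (hcot φ.symm _ _ (by fun_prop) ?_).antisymm (hcot φ _ _ hf hφ)
    rw [← hφ, ← image_comp]
    simp
  choose! φ hφ using h
  have hent := fun c hc => exists_entries_of_isometry (φ c) (hφ c hc)
  choose! p q r w s t ho hmap hsurj using hent
  let F : ℝ → ℝ × ℝ × ℝ × ℝ := fun c => (p c, q c, r c, w c)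
  have hF : MapsTo F C ({0, 1, -1} ×ˢ {0, 1, -1} ×ˢ {0, 1, -1} ×ˢ {0, 1, -1}) := fun c hc => by
    refine (ho c hc).mem_of_mul_eq_zero (mul_eq_zero_of_mapsSlopes (ho c hc) (hC hc)
      (isPreconnected_chordSlopes hf) ?_ hend)
    rw [← chordSlopes_const_mul (ne_of_gt (hC hc))]
    exact mapsSlopes_chordSlopes (ho c hc) (hmap c hc)
  obtain ⟨y, hy⟩ : ∃ y, ¬ (C ∩ F ⁻¹' {y}).Countable := by
    by_contra! hall
    have hfin : ({0, 1, -1} : Set ℝ).Finite := toFinite _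
    have hcount := (hfin.prod (hfin.prod (hfin.prod hfin))).countable.biUnion fun y _ => hall y
    refine hCu (hcount.mono fun c hc => ?_)
    exact mem_iUnion₂.2 ⟨F c, hF hc, hc, rfl⟩
  obtain ⟨c₁, hc₁, hy₁⟩ : (C ∩ F ⁻¹' {y}).Nonempty := by
    rw [nonempty_iff_ne_empty]
    rintro he
    simp [he] at hy
  refine affine_or_exp_of_translations hf (inter_subset_left.trans hC) hy (c₁ := c₁)
    (ne_of_gt (hC hc₁)) ?_
  rintro c ⟨hc, hyc⟩
  have hFc : F c = F c₁ := (mem_singleton_iff.1 hyc).trans (mem_singleton_iff.1 hy₁).symm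
  simp only [F, Prod.mk.injEq] at hFc
  obtain ⟨h1, h2, h3, h4⟩ := hFc
  refine ⟨s c - s c₁, t c - t c₁, fun X => ?_⟩
  obtain ⟨x, rfl⟩ := hsurj c₁ hc₁ X
  have e1 := hmap c hc x
  have e2 := hmap c₁ hc₁ x
  rw [h1, h2, h3, h4] at e1
  rw [add_add_sub_cancel, e1, e2]
  ring

/-- The plane isometry with linear part `!![p, -q; q, p]` and translation part `(s, t)`. -/
def rotationTranslation (p q s t : ℝ) (h : p ^ 2 + q ^ 2 = 1) : E2 ≃ᵢ E2 :=
  IsometryEquiv.mk' (fun v => !₂[p * v 0 - q * v 1 + s, q * v 0 + p * v 1 + t])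
    (fun v => !₂[p * (v 0 - s) + q * (v 1 - t), -q * (v 0 - s) + p * (v 1 - t)])
    (fun v => by
      ext i
      fin_cases i
      · simp
        linear_combination (v 0 - s) * h
      · simp
        linear_combination (v 1 - t) * h)
    (Isometry.of_dist_eq fun v v' => by
      simp only [EuclideanSpace.dist_eq, Fin.sum_univ_two, Real.dist_eq, sq_abs]
      congr 1
      simp
      linear_combination ((v 0 - v' 0) ^ 2 + (v 1 - v' 1) ^ 2) * h)

theorem rotationTranslation_image_graph {p q s t : ℝ} (h : p ^ 2 + q ^ 2 = 1) {f g : ℝ → ℝ}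
    (hfg : ∀ x y, y = f x ↔ q * x + p * y + t = g (p * x - q * y + s)) :
    rotationTranslation p q s t h '' graphOf1 f = graphOf1 g := by
  have hpre : graphOf1 f = rotationTranslation p q s t h ⁻¹' graphOf1 g := by
    ext v
    exact hfg (v 0) (v 1)
  rw [hpre, image_preimage_eq _ (rotationTranslation p q s t h).surjective]

theorem exists_isometry_of_affine (a b c : ℝ) :
    ∃ φ : E2 ≃ᵢ E2, φ '' graphOf1 (fun x => a + b * x) =
      graphOf1 (fun x => c * (a + b * x)) := by
  have hN : 0 < (1 + b ^ 2) * (1 + (c * b) ^ 2) := by positivity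
  obtain ⟨N, hNpos, hN2⟩ : ∃ N : ℝ, 0 < N ∧ N ^ 2 = (1 + b ^ 2) * (1 + (c * b) ^ 2) :=
    ⟨√((1 + b ^ 2) * (1 + (c * b) ^ 2)), Real.sqrt_pos.2 hN, Real.sq_sqrt hN.le⟩
  obtain ⟨p, hp⟩ : ∃ p, p = (1 + c * b ^ 2) / N := ⟨_, rfl⟩
  obtain ⟨q, hq⟩ : ∃ q, q = (c * b - b) / N := ⟨_, rfl⟩
  have hpq : p ^ 2 + q ^ 2 = 1 := by
    rw [hp, hq]
    field_simp
    rw [hN2]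
    ring
  have hdir : q + p * b = c * b * (p - q * b) := by
    rw [hp, hq]
    field_simp
    ring
  have hne : p + c * b * q ≠ 0 := by
    have : p + c * b * q = (1 + (c * b) ^ 2) / N := by
      rw [hp, hq]
      field_simp
      ring
    rw [this]
    positivity
  refine ⟨rotationTranslation p q (q * a) (c * a - p * a) hpq,
    rotationTranslation_image_graph hpq fun x y => ?_⟩
  rw [← sub_eq_zero, ← mul_right_inj' hne, mul_zero, ← sub_eq_zero (a := q * x + p * y + _)]
  apply Eq.congr_left
  linear_combination -x * hdir

theorem exists_isometry_of_exp (a b : ℝ) {k c : ℝ} (hk : k ≠ 0) (hc : 0 < c) :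
    ∃ φ : E2 ≃ᵢ E2, φ '' graphOf1 (fun x => a + b * Real.exp (k * x)) =
      graphOf1 (fun x => c * (a + b * Real.exp (k * x))) := by
  refine ⟨rotationTranslation 1 0 (-(Real.log c / k)) (c * a - a) (by norm_num),
    rotationTranslation_image_graph _ fun x y => ?_⟩
  have : k * (1 * x - 0 * y + -(Real.log c / k)) = k * x - Real.log c := by
    field_simp
    ring
  rw [this, Real.exp_sub, Real.exp_log hc]
  field_simp
  constructor <;> intro h <;> linarith

/-- for uncountable C ⊆ (0,∞), a continuous f : ℝ → ℝ is vertically rigid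
for C iff it is of the form a + b·x or a + b·e^{kx} with k ≠ 0. -/
theorem stmt2 (C : Set ℝ) (hC : C ⊆ Set.Ioi 0) (hCu : ¬ C.Countable)
    (f : ℝ → ℝ) (hf : Continuous f) :
    (∀ c ∈ C, ∃ φ : E2 ≃ᵢ E2, φ '' graphOf1 f = graphOf1 (fun x => c * f x)) ↔
    ((∃ a b : ℝ, ∀ x : ℝ, f x = a + b * x) ∨
     (∃ a b k : ℝ, k ≠ 0 ∧ ∀ x : ℝ, f x = a + b * Real.exp (k * x))) := by
  refine ⟨affine_or_exp_of_rigid hf hC hCu, ?_⟩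
  rintro (⟨a, b, h⟩ | ⟨a, b, k, hk, h⟩) c hc
  · obtain rfl : f = fun x => a + b * x := funext h
    exact exists_isometry_of_affine a b c
  · obtain rfl : f = fun x => a + b * Real.exp (k * x) := funext h
    exact exists_isometry_of_exp a b hk (hC hc)
end
end

section
/- Let C ⊆ (0,∞) be an uncountable set. A continuous function f : ℝ² → ℝ is vertically rigid for C via horizontal translations if and only if there is a rotation of ℝ³ around the z-axis taking graph(f) to the graph of a function of the form (x,y) ↦ s(y)·e^{k·x}, where k ∈ ℝ, k ≠ 0, and s : ℝ → ℝ is continuous. -/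
open Real Set

noncomputable section

open Filter Topology

section ClosedSubgroup

variable {E : Type*} [NormedAddCommGroup E] [NormedSpace ℝ E]

/-- A closed additive subgroup of a finite-dimensional real space in which `0` is an accumulation
point contains a line. -/
theorem AddSubgroup.exists_line_of_accPt [FiniteDimensional ℝ E] (G : AddSubgroup E)
    (hG : IsClosed (G : Set E)) (h0 : AccPt (0 : E) (𝓟 (G : Set E))) :
    ∃ v : E, v ≠ 0 ∧ ∀ r : ℝ, r • v ∈ G := by
  have : ProperSpace E := FiniteDimensional.proper ℝ E
  have : NeBot (𝓝[≠] (0 : E) ⊓ 𝓟 (G : Set E)) := h0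
  let l : Ultrafilter E := Ultrafilter.of (𝓝[≠] (0 : E) ⊓ 𝓟 (G : Set E))
  have hl : (l : Filter E) ≤ 𝓝[≠] (0 : E) ⊓ 𝓟 (G : Set E) := Ultrafilter.of_le _
  have hne : ∀ᶠ u in (l : Filter E), u ≠ 0 :=
    hl.trans inf_le_left self_mem_nhdsWithin
  have hmem : ∀ᶠ u in (l : Filter E), u ∈ G := hl.trans inf_le_right (mem_principal_self _)
  have hto : Tendsto (fun u : E => ‖u‖) l (𝓝 0) := by
    have : Tendsto (fun u : E => ‖u‖) (𝓝 0) (𝓝 0) := tendsto_norm_zero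
    exact this.mono_left (hl.trans (inf_le_left.trans nhdsWithin_le_nhds))
  obtain ⟨v, hv, hlim⟩ := (isCompact_sphere (0 : E) 1).ultrafilter_le_nhds
    (l.map fun u => ‖u‖⁻¹ • u) (by
      rw [le_principal_iff, Ultrafilter.coe_map, Filter.mem_map]
      filter_upwards [hne] with u hu
      simp [norm_smul, hu])
  have hlim' : Tendsto (fun u : E => ‖u‖⁻¹ • u) l (𝓝 v) := hlim
  refine ⟨v, ?_, fun r => ?_⟩
  · rintro rfl
    simp at hv
  · have hround : Tendsto (fun u : E => (round (r / ‖u‖) : ℝ) * ‖u‖) l (𝓝 r) := by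
      rw [tendsto_iff_norm_sub_tendsto_zero]
      refine squeeze_zero' (Eventually.of_forall fun _ => norm_nonneg _) ?_ hto
      filter_upwards [hne] with u hu
      have hu' : 0 < ‖u‖ := norm_pos_iff.mpr hu
      have h1 := abs_sub_round (r / ‖u‖)
      have h2 : (round (r / ‖u‖) : ℝ) * ‖u‖ - r = -((r / ‖u‖ - round (r / ‖u‖)) * ‖u‖) := by
        field_simp
        ring
      rw [h2, norm_neg, norm_mul, norm_norm, Real.norm_eq_abs]
      nlinarith
    refine hG.mem_of_tendsto (hround.smul hlim') ?_
    filter_upwards [hne, hmem] with u hu hmu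
    have hu' : ‖u‖ ≠ 0 := norm_ne_zero_iff.mpr hu
    rw [smul_smul, mul_assoc, mul_inv_cancel₀ hu', mul_one, Int.cast_smul_eq_zsmul]
    exact G.zsmul_mem hmu _

/-- A closed additive subgroup of a finite-dimensional real space containing no line is
countable. -/
theorem AddSubgroup.countable_of_no_line [FiniteDimensional ℝ E] (G : AddSubgroup E)
    (hG : IsClosed (G : Set E)) (hline : ∀ v : E, (∀ r : ℝ, r • v ∈ G) → v = 0) :
    (G : Set E).Countable := by
  have h0 : ¬ AccPt (0 : E) (𝓟 (G : Set E)) := fun h => by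
    obtain ⟨v, hv, hr⟩ := G.exists_line_of_accPt hG h
    exact hv (hline v hr)
  have hopen : IsOpen ({0} : Set G) := by
    rw [accPt_iff_nhds] at h0
    push Not at h0
    obtain ⟨U, hU, h⟩ := h0
    refine isOpen_singleton_iff_nhds_eq_pure _ |>.mpr (le_antisymm ?_ (pure_le_nhds _))
    rw [le_pure_iff, nhds_subtype]
    refine ⟨U, hU, fun x hx => ?_⟩
    exact Subtype.ext (h x ⟨hx, x.2⟩)
  have : DiscreteTopology G := discreteTopology_of_isOpen_singleton_zero hopen
  have : SecondCountableTopology E :=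
    have : ProperSpace E := FiniteDimensional.proper ℝ E
    inferInstance
  have : Countable G := TopologicalSpace.separableSpace_iff_countable.mp inferInstance
  exact Set.countable_coe_iff.mp this

/-- The largest linear subspace contained in an additive subgroup. -/
def AddSubgroup.lineSubmodule (G : AddSubgroup E) : Submodule ℝ E where
  carrier := {v | ∀ r : ℝ, r • v ∈ G}
  zero_mem' r := by simp
  add_mem' {u v} hu hv r := by
    rw [smul_add]
    exact G.add_mem (hu r) (hv r)
  smul_mem' c v hv r := by
    rw [smul_smul]
    exact hv _

/-- A closed additive subgroup of a finite-dimensional real space is the sum of a linear subspace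
and a countable set. -/
theorem AddSubgroup.exists_countable_add_line [FiniteDimensional ℝ E] (G : AddSubgroup E)
    (hG : IsClosed (G : Set E)) :
    ∃ S : Set E, S.Countable ∧ S ⊆ G ∧
      ∀ g ∈ G, ∃ v : E, (∀ r : ℝ, r • v ∈ G) ∧ ∃ h ∈ S, v + h = g := by
  obtain ⟨W, hW⟩ := G.lineSubmodule.exists_isCompl
  have hclosed : IsClosed ((G ⊓ W.toAddSubgroup : AddSubgroup E) : Set E) :=
    hG.inter W.closed_of_finiteDimensional
  refine ⟨_, (G ⊓ W.toAddSubgroup).countable_of_no_line hclosed fun v hv => ?_,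
    inter_subset_left, fun g hg => ?_⟩
  · refine Submodule.disjoint_def.mp hW.disjoint v (fun r => (hv r).1) ?_
    simpa using (hv 1).2
  · obtain ⟨v, hv, w, hw, rfl⟩ :=
      Submodule.mem_sup.mp (hW.sup_eq_top ▸ Submodule.mem_top : g ∈ G.lineSubmodule ⊔ W)
    refine ⟨v, hv, w, ⟨?_, hw⟩, rfl⟩
    have h1 : v ∈ G := by simpa using hv 1
    exact (G.add_mem_cancel_left h1).mp hg

end ClosedSubgroup

/-- A continuous positive function on `ℝ` turning sums into products is an exponential. -/
theorem exists_eq_exp_of_map_add {χ : ℝ → ℝ} (hχ : Continuous χ) (hpos : ∀ r, 0 < χ r)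
    (hadd : ∀ r s, χ (r + s) = χ r * χ s) : ∃ k : ℝ, ∀ r, χ r = Real.exp (k * r) := by
  let φ : ℝ →+ ℝ := AddMonoidHom.mk' (fun r => Real.log (χ r)) fun r s => by
    rw [hadd, Real.log_mul (hpos r).ne' (hpos s).ne']
  have hφ : Continuous φ := hχ.log fun r => (hpos r).ne'
  refine ⟨φ 1, fun r => ?_⟩
  have h := map_real_smul φ hφ r 1
  rw [smul_eq_mul, mul_one, smul_eq_mul, mul_comm] at h
  rw [← h]
  exact (Real.exp_log (hpos r)).symm

section Multipliers

variable {E : Type*} [NormedAddCommGroup E]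

/-- The translations that multiply `f` by a positive constant. -/
def multiplierSubgroup (f : E → ℝ) : AddSubgroup E where
  carrier := {t | ∃ c : ℝ, 0 < c ∧ ∀ x, f (x + t) = c * f x}
  zero_mem' := ⟨1, one_pos, by simp⟩
  add_mem' := by
    rintro t u ⟨c, hc, ht⟩ ⟨d, hd, hu⟩
    refine ⟨d * c, mul_pos hd hc, fun x => ?_⟩
    rw [← add_assoc, hu, ht, mul_assoc]
  neg_mem' := by
    rintro t ⟨c, hc, ht⟩
    refine ⟨c⁻¹, inv_pos.mpr hc, fun x => ?_⟩
    have h := ht (x + -t)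
    rw [neg_add_cancel_right] at h
    rw [h, inv_mul_cancel_left₀ hc.ne']

variable {f : E → ℝ} {x₀ : E}

theorem multiplierSubgroup.ratio_spec (hx₀ : f x₀ ≠ 0) {t : E} (ht : t ∈ multiplierSubgroup f) :
    0 < f (x₀ + t) / f x₀ ∧ ∀ x, f (x + t) = f (x₀ + t) / f x₀ * f x := by
  obtain ⟨c, hc, h⟩ := ht
  have : f (x₀ + t) / f x₀ = c := by rw [h, mul_div_cancel_right₀ _ hx₀]
  rw [this]
  exact ⟨hc, h⟩

theorem multiplierSubgroup.isClosed (hf : Continuous f) (hx₀ : f x₀ ≠ 0) :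
    IsClosed (multiplierSubgroup f : Set E) := by
  have heq : (multiplierSubgroup f : Set E) =
      {t | 0 ≤ f (x₀ + t) / f x₀ ∧ ∀ x, f (x + t) = f (x₀ + t) / f x₀ * f x} := by
    ext t
    refine ⟨fun ht => ?_, fun ht => ⟨_, lt_of_le_of_ne ht.1 fun h0 => hx₀ ?_, ht.2⟩⟩
    · exact ⟨(multiplierSubgroup.ratio_spec hx₀ ht).1.le,
        (multiplierSubgroup.ratio_spec hx₀ ht).2⟩
    · have h := ht.2 (x₀ + -t)
      rwa [neg_add_cancel_right, ← h0, zero_mul] at h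
  rw [heq, ofPred_and, ofPred_forall]
  refine (isClosed_le (by fun_prop) (by fun_prop)).inter (isClosed_iInter fun x => ?_)
  exact isClosed_eq (by fun_prop) (by fun_prop)

/-- If a nonzero continuous function admits uncountably many multipliers, it is exponential
along some direction. -/
theorem exists_exponential_direction [NormedSpace ℝ E] [FiniteDimensional ℝ E]
    {C : Set ℝ} (hC : C ⊆ Set.Ioi 0) (hCu : ¬ C.Countable) (hf : Continuous f) (hx₀ : f x₀ ≠ 0)
    (h : ∀ c ∈ C, ∃ t : E, ∀ x : E, f (x + t) = c * f x) :
    ∃ (v : E) (k : ℝ), k ≠ 0 ∧ ∀ (x : E) (r : ℝ), f (x + r • v) = Real.exp (k * r) * f x := by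
  obtain ⟨S, hS, hSG, hdec⟩ :=
    (multiplierSubgroup f).exists_countable_add_line (multiplierSubgroup.isClosed hf hx₀)
  obtain ⟨v, hv, hv1⟩ : ∃ v : E, (∀ r : ℝ, r • v ∈ multiplierSubgroup f) ∧
      f (x₀ + v) / f x₀ ≠ 1 := by
    by_contra! hcon
    refine hCu ((hS.image fun t => f (x₀ + t) / f x₀).mono fun c hc => ?_)
    obtain ⟨t, ht⟩ := h c hc
    obtain ⟨v, hv, s, hs, rfl⟩ := hdec t ⟨c, hC hc, ht⟩
    refine ⟨s, hs, ?_⟩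
    have h1 : v ∈ multiplierSubgroup f := by simpa using hv 1
    have h2 := (multiplierSubgroup.ratio_spec hx₀ h1).2 (x₀ + s)
    rw [hcon v hv, one_mul, add_assoc, add_comm s v, ht] at h2
    change f (x₀ + s) / f x₀ = c
    rw [← h2, mul_div_cancel_right₀ _ hx₀]
  obtain ⟨k, hk⟩ := exists_eq_exp_of_map_add (χ := fun r : ℝ => f (x₀ + r • v) / f x₀)
    (by fun_prop) (fun r => (multiplierSubgroup.ratio_spec hx₀ (hv r)).1) fun r s => by
      have := (multiplierSubgroup.ratio_spec hx₀ (hv r)).2 (x₀ + s • v)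
      rw [add_smul, add_comm (r • v), ← add_assoc, this, mul_div_assoc]
  refine ⟨v, k, ?_, fun x r => ?_⟩
  · rintro rfl
    exact hv1 (by simpa using hk 1)
  · rw [← hk r]
    exact (multiplierSubgroup.ratio_spec hx₀ (hv r)).2 x

end Multipliers

/-- Polar coordinates of a nonzero vector of the plane. -/
theorem exists_polar_of_ne_zero {v : ℝ × ℝ} (hv : v ≠ 0) :
    ∃ ρ θ : ℝ, ρ ≠ 0 ∧ v = ρ • (Real.cos θ, Real.sin θ) := by
  let z : ℂ := ⟨v.1, v.2⟩
  have hz : z ≠ 0 := fun h => hv (Prod.ext (congrArg Complex.re h) (congrArg Complex.im h))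
  refine ⟨‖z‖, z.arg, norm_ne_zero_iff.mpr hz, Prod.ext ?_ ?_⟩
  · simp [z]
  · simp [z]

/-- for uncountable C ⊆ (0,∞), a continuous f : ℝ² → ℝ is vertically rigid
for C via horizontal translations (i.e. ∀ c ∈ C, ∃ t ∈ ℝ², f(x+t) = c·f(x) for all x)
iff after a suitable rotation around the z-axis it is of the form (x,y) ↦ s(y)·e^{kx}. -/
theorem stmt3 (C : Set ℝ) (hC : C ⊆ Set.Ioi 0) (hCu : ¬ C.Countable)
    (f : ℝ × ℝ → ℝ) (hf : Continuous f) :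
    (∀ c ∈ C, ∃ t : ℝ × ℝ, ∀ x : ℝ × ℝ, f (x + t) = c * f x) ↔
    (∃ (θ k : ℝ) (s : ℝ → ℝ), k ≠ 0 ∧ Continuous s ∧ ∀ x y : ℝ,
        f (Real.cos θ * x - Real.sin θ * y, Real.sin θ * x + Real.cos θ * y)
          = s y * Real.exp (k * x)) := by
  constructor
  · intro h
    by_cases hzero : ∀ x, f x = 0
    · exact ⟨0, 1, fun _ => 0, one_ne_zero, continuous_const, fun x y => by simp [hzero]⟩
    push Not at hzero
    obtain ⟨x₀, hx₀⟩ := hzero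
    obtain ⟨v, k, hk, hexp⟩ := exists_exponential_direction hC hCu hf hx₀ h
    have hv : v ≠ 0 := by
      rintro rfl
      have h1 := hexp x₀ 1
      rw [smul_zero, add_zero, eq_comm, mul_eq_right₀ hx₀, mul_one, Real.exp_eq_one_iff] at h1
      exact hk h1
    obtain ⟨ρ, θ, hρ, rfl⟩ := exists_polar_of_ne_zero hv
    refine ⟨θ, k / ρ, fun y => f (-Real.sin θ * y, Real.cos θ * y), div_ne_zero hk hρ,
      by fun_prop, fun x y => ?_⟩
    have h1 := hexp (-Real.sin θ * y, Real.cos θ * y) (x / ρ)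
    rw [smul_smul, div_mul_cancel₀ _ hρ] at h1
    rw [div_mul_eq_mul_div, mul_div_assoc]
    refine Eq.trans ?_ (h1.trans (mul_comm _ _))
    congr 1
    ext
    · simp
      ring
    · simp
      ring
  · rintro ⟨θ, k, s, hk, -, h⟩ c hc
    refine ⟨(Real.cos θ * (Real.log c / k), Real.sin θ * (Real.log c / k)), fun p => ?_⟩
    set x := Real.cos θ * p.1 + Real.sin θ * p.2
    set y := -Real.sin θ * p.1 + Real.cos θ * p.2
    have hp : p = (Real.cos θ * x - Real.sin θ * y, Real.sin θ * x + Real.cos θ * y) := by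
      ext
      · linear_combination (-p.1) * Real.sin_sq_add_cos_sq θ
      · linear_combination (-p.2) * Real.sin_sq_add_cos_sq θ
    have hpt : p + (Real.cos θ * (Real.log c / k), Real.sin θ * (Real.log c / k)) =
        (Real.cos θ * (x + Real.log c / k) - Real.sin θ * y,
          Real.sin θ * (x + Real.log c / k) + Real.cos θ * y) := by
      rw [hp, Prod.mk_add_mk]
      ext
      · ring
      · ring
    have hfp : f p = s y * Real.exp (k * x) := by rw [← h, ← hp]
    rw [hpt, h, hfp, mul_add, mul_div_cancel₀ _ hk, Real.exp_add, Real.exp_log (hC hc)]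
    ring
end
end

section
/- Let f : ℝ → ℝ be a continuous function that is vertically rigid for an uncountable set C ⊆ (0,∞) via horizontal translations, i.e., for every c ∈ C there exists t ∈ ℝ with f(x + t) = c·f(x) for all x ∈ ℝ. Then f is of the form f(x) = s·e^{k·x} for some s ∈ ℝ and k ∈ ℝ \ {0}. -/
open Real Set

/-- The additive subgroup of all `t` such that translating `f` by `t` multiplies `f` by a constant;
the condition is written without the constant, so that it is visibly closed in `t`. -/
def translationSubgroup (f : ℝ → ℝ) {x₀ : ℝ} (hx₀ : f x₀ ≠ 0) : AddSubgroup ℝ where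
  carrier := {t | ∀ x y, f (x + t) * f y = f x * f (y + t)}
  zero_mem' := by simp
  add_mem' := by
    intro s t hs ht x y
    have key : ∀ z, f (z + (s + t)) * f x₀ ^ 2 = f z * (f (x₀ + s) * f (x₀ + t)) := by
      intro z
      rw [← add_assoc]
      linear_combination f x₀ * ht (z + s) x₀ + f (x₀ + t) * hs z x₀
    apply mul_right_cancel₀ (pow_ne_zero 2 hx₀)
    linear_combination f y * key x - f x * key y
  neg_mem' := by
    intro t ht x y
    have h := ht (x + -t) (y + -t)
    simp only [neg_add_cancel_right] at h
    exact h.symm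

theorem isClosed_translationSubgroup {f : ℝ → ℝ} (hf : Continuous f) {x₀ : ℝ} (hx₀ : f x₀ ≠ 0) :
    IsClosed (translationSubgroup f hx₀ : Set ℝ) := by
  change IsClosed {t | ∀ x y, f (x + t) * f y = f x * f (y + t)}
  simp only [Set.ofPred_forall]
  exact isClosed_iInter fun x => isClosed_iInter fun y =>
    isClosed_eq (by fun_prop) (by fun_prop)

theorem AddSubgroup.eq_univ_of_isClosed_of_not_countable {S : AddSubgroup ℝ}
    (hS : IsClosed (S : Set ℝ)) (hu : ¬ (S : Set ℝ).Countable) : (S : Set ℝ) = univ := by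
  rcases S.dense_or_cyclic with h | ⟨a, rfl⟩
  · rw [← hS.closure_eq, h.closure_eq]
  · refine absurd ?_ hu
    have : (AddSubgroup.closure {a} : Set ℝ) = range fun n : ℤ => n • a := by
      ext x
      simp [AddSubgroup.mem_closure_singleton]
    rw [this]
    exact countable_range _

/-- A continuous solution of the exponential Cauchy equation is an exponential. -/
theorem exists_eq_exp_of_map_add_eq_mul {g : ℝ → ℝ} (hg : Continuous g) (h0 : g 0 = 1)
    (hadd : ∀ x y, g (x + y) = g x * g y) : ∃ k : ℝ, ∀ x, g x = Real.exp (k * x) := by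
  have hne : ∀ x, g x ≠ 0 := by
    intro x hx
    have h := hadd x (-x)
    simp [h0, hx] at h
  have hpos : ∀ x, 0 < g x := by
    intro x
    have h := hadd (x / 2) (x / 2)
    rw [add_halves] at h
    rw [h]
    exact mul_self_pos.2 (hne _)
  let L : ℝ →+ ℝ :=
    { toFun := fun x => Real.log (g x)
      map_zero' := by simp [h0]
      map_add' := fun x y => by rw [hadd, Real.log_mul (hne x) (hne y)] }
  have hL : Continuous L := hg.log hne
  refine ⟨L 1, fun x => ?_⟩
  have h : L x = L 1 * x := by
    have := map_real_smul L hL x 1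
    simpa [mul_comm] using this
  rw [← h]
  exact (Real.exp_log (hpos x)).symm

/-- a continuous f : ℝ → ℝ that is vertically rigid for an uncountable
C ⊆ (0,∞) via horizontal translations is of the form s·e^{kx} with k ≠ 0. -/
theorem stmt4 (C : Set ℝ) (hC : C ⊆ Set.Ioi 0) (hCu : ¬ C.Countable)
    (f : ℝ → ℝ) (hf : Continuous f)
    (hrig : ∀ c ∈ C, ∃ t : ℝ, ∀ x : ℝ, f (x + t) = c * f x) :
    ∃ s k : ℝ, k ≠ 0 ∧ ∀ x : ℝ, f x = s * Real.exp (k * x) := by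
  by_cases hzero : ∀ x, f x = 0
  · exact ⟨0, 1, one_ne_zero, by simpa using hzero⟩
  push Not at hzero
  obtain ⟨x₀, hx₀⟩ := hzero
  have hu : ¬ (translationSubgroup f hx₀ : Set ℝ).Countable := by
    refine fun hcount => hCu ((hcount.image fun t => f (x₀ + t) / f x₀).mono ?_)
    intro c hc
    obtain ⟨t, ht⟩ := hrig c hc
    refine ⟨t, fun x y => ?_, ?_⟩
    · rw [ht, ht]; ring
    · simp only [ht, mul_div_cancel_right₀ _ hx₀]
  have huniv := AddSubgroup.eq_univ_of_isClosed_of_not_countable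
    (isClosed_translationSubgroup hf hx₀) hu
  have hmul : ∀ t x y, f (x + t) * f y = f x * f (y + t) := fun t =>
    (huniv ▸ mem_univ t : t ∈ (translationSubgroup f hx₀ : Set ℝ))
  have hf0 : f 0 ≠ 0 := by
    intro h
    have := hmul x₀ x₀ 0
    simp [h, hx₀] at this
  obtain ⟨k, hk⟩ := exists_eq_exp_of_map_add_eq_mul (g := fun x => f x / f 0)
    (hf.div_const _) (div_self hf0) (fun x y => by
      have := hmul y x 0
      rw [zero_add] at this
      field_simp
      linear_combination this)
  have hform : ∀ x, f x = f 0 * Real.exp (k * x) := fun x => by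
    rw [← hk x, mul_div_cancel₀ _ hf0]
  refine ⟨f 0, k, ?_, hform⟩
  rintro rfl
  have hconst : ∀ x, f x = f 0 := fun x => by simpa using hform x
  refine hCu ((countable_singleton (1 : ℝ)).mono fun c hc => ?_)
  obtain ⟨t, ht⟩ := hrig c hc
  have h := ht 0
  rw [hconst (0 + t)] at h
  exact mul_right_cancel₀ hf0 (by rw [one_mul, ← h])
end

section
/- Let C ⊆ (0,∞) and let f : ℝ² → ℝ be vertically rigid for C via horizontal translations, with f(0,0) = 1. Let T' = {t ∈ ℝ² : ∃ c ∈ C such that f(x + t) = c·f(x) for all x ∈ ℝ²}, and let T be the additive subgroup of ℝ² generated by T'. Then f(x + t) = f(x)·f(t) for all x ∈ ℝ² and all t ∈ T; moreover f(t) > 0 for every t ∈ T, and if C is uncountable then T' is uncountable. -/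
open Real Set

/-- The vectors `t` with `0 < f t` along which translation multiplies `f` by `f t` form an
additive subgroup, provided `f 0 = 1`. -/
def multiplicativePeriods {G : Type*} [AddCommGroup G] (f : G → ℝ) (hf0 : f 0 = 1) :
    AddSubgroup G where
  carrier := {t | 0 < f t ∧ ∀ x, f (x + t) = f x * f t}
  zero_mem' := by simp [hf0]
  add_mem' := by
    rintro s t ⟨hs, hs'⟩ ⟨ht, ht'⟩
    refine ⟨by rw [ht']; positivity, fun x => ?_⟩
    rw [← add_assoc, ht', hs', ht', mul_assoc]
  neg_mem' := by
    rintro t ⟨ht, ht'⟩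
    have hinv : f (-t) * f t = 1 := by rw [← ht', neg_add_cancel, hf0]
    refine ⟨pos_of_mul_pos_left (hinv ▸ one_pos) ht.le, fun x => ?_⟩
    have hx : f x = f (x + -t) * f t := by rw [← ht', neg_add_cancel_right]
    rw [hx, mul_assoc, mul_comm (f t), hinv, mul_one]

/-- multiplicativity of f on the group generated by the translation vectors. -/
theorem stmt6 (C : Set ℝ) (hC : C ⊆ Set.Ioi 0) (f : ℝ × ℝ → ℝ)
    (hrig : ∀ c ∈ C, ∃ t : ℝ × ℝ, ∀ x : ℝ × ℝ, f (x + t) = c * f x)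
    (hf0 : f 0 = 1)
    (T' : Set (ℝ × ℝ)) (hT' : T' = {t : ℝ × ℝ | ∃ c ∈ C, ∀ x : ℝ × ℝ, f (x + t) = c * f x})
    (T : AddSubgroup (ℝ × ℝ)) (hT : T = AddSubgroup.closure T') :
    (∀ x : ℝ × ℝ, ∀ t ∈ T, f (x + t) = f x * f t) ∧
    (∀ t ∈ T, 0 < f t) ∧
    (¬ C.Countable → ¬ T'.Countable) := by
  subst hT' hT
  have factor_eq {c : ℝ} {t : ℝ × ℝ} (h : ∀ x, f (x + t) = c * f x) : f t = c := by
    simpa [hf0] using h 0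
  have hle : AddSubgroup.closure {t : ℝ × ℝ | ∃ c ∈ C, ∀ x : ℝ × ℝ, f (x + t) = c * f x} ≤
      multiplicativePeriods f hf0 := by
    rw [AddSubgroup.closure_le]
    rintro t ⟨c, hc, h⟩
    obtain rfl := factor_eq h
    exact ⟨hC hc, fun x => by rw [h, mul_comm]⟩
  refine ⟨fun x t ht => (hle ht).2 x, fun t ht => (hle ht).1, mt fun hcount => ?_⟩
  refine (hcount.image f).mono fun c hc => ?_
  obtain ⟨t, h⟩ := hrig c hc
  exact ⟨t, ⟨c, hc, h⟩, factor_eq h⟩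
end

section
/- Let f : ℝ² → ℝ be an arbitrary function that is vertically rigid for a set C ⊆ (0,∞) via translations, i.e., for every c ∈ C there exist t ∈ ℝ² and u ∈ ℝ such that f(x + t) + u = c·f(x) for all x ∈ ℝ². Then there exists a ∈ ℝ such that f − a is vertically rigid for the same set C via horizontal translations, i.e., for every c ∈ C there exists t ∈ ℝ² with (f − a)(x + t) = c·(f − a)(x) for all x ∈ ℝ². -/
open Real Set

/-- if f : ℝ² → ℝ is vertically rigid for C via translations, then for some
a ∈ ℝ the function f − a is vertically rigid for the same C via horizontal translations. -/
theorem stmt7 (C : Set ℝ) (hC : C ⊆ Set.Ioi 0) (f : ℝ × ℝ → ℝ)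
    (hrig : ∀ c ∈ C, ∃ (t : ℝ × ℝ) (u : ℝ), ∀ x : ℝ × ℝ, f (x + t) + u = c * f x) :
    ∃ a : ℝ, ∀ c ∈ C, ∃ t : ℝ × ℝ, ∀ x : ℝ × ℝ, f (x + t) - a = c * (f x - a) := by
  by_cases h : ∃ d ∈ C, d ≠ 1
  · obtain ⟨d, hd, hd1⟩ := h
    obtain ⟨s, v, hs⟩ := hrig d hd
    have hd0 : d - 1 ≠ 0 := sub_ne_zero.mpr hd1
    refine ⟨v / (d - 1), fun c hc => ?_⟩
    by_cases hc1 : c = 1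
    · exact ⟨0, fun x => by simp [hc1]⟩
    obtain ⟨t, u, ht⟩ := hrig c hc
    -- The affine maps `y ↦ c * y - u` and `y ↦ d * y - v` commute on the range of `f`.
    have key : u * (d - 1) = v * (c - 1) := by
      have h1 := ht (0 + s)
      have h2 := hs (0 + t)
      rw [add_right_comm] at h2
      linear_combination h2 - h1 + d * ht 0 - c * hs 0
    have hu : u = (c - 1) * (v / (d - 1)) := by
      field_simp
      linear_combination key
    exact ⟨t, fun x => by linear_combination ht x - hu⟩
  · push Not at h
    exact ⟨0, fun c hc => ⟨0, fun x => by simp [h c hc]⟩⟩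
end

section
/- Let C ⊆ (0,∞) be an uncountable set. A continuous function f : ℝ² → ℝ is vertically rigid for C via translations if and only if there is a rotation of ℝ³ around the z-axis taking graph(f) to the graph of a function of the form (x,y) ↦ a + s(y)·e^{k·x}, where a, k ∈ ℝ, k ≠ 0, and s : ℝ → ℝ is continuous. -/
open Real Set

open Filter Topology in
/-- An uncountable closed subgroup of a proper real normed space contains a line. -/
theorem AddSubgroup.exists_line_of_isClosed_of_not_countable {E : Type*} [NormedAddCommGroup E]
    [NormedSpace ℝ E] [ProperSpace E] (T : AddSubgroup E) (hT : IsClosed (T : Set E))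
    (hu : ¬ (T : Set E).Countable) : ∃ w : E, w ≠ 0 ∧ ∀ r : ℝ, r • w ∈ T := by
  have hsmall : ∀ ε : ℝ, 0 < ε → ∃ d ∈ T, d ≠ 0 ∧ ‖d‖ < ε := by
    intro ε hε
    by_contra! h
    apply hu
    have : DiscreteTopology T := by
      apply discreteTopology_of_isOpen_singleton_zero
      have : ({0} : Set T) = (fun t : T => ‖(t : E)‖) ⁻¹' Iio ε := by
        ext t
        simp only [mem_singleton_iff, mem_preimage, mem_Iio]
        constructor
        · rintro rfl
          simpa using hε
        · intro ht
          by_contra h0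
          exact absurd (h t t.2 (by simpa using h0)) (not_le.mpr ht)
      rw [this]
      exact isOpen_Iio.preimage (by fun_prop)
    have hc : Countable T := TopologicalSpace.separableSpace_iff_countable.mp inferInstance
    exact hc
  choose d hdT hd0 hdn using fun n : ℕ => hsmall (1 / ((n : ℝ) + 1)) (by positivity)
  have hd : Tendsto (fun n => ‖d n‖) atTop (𝓝 0) :=
    squeeze_zero (fun n => norm_nonneg _) (fun n => (hdn n).le)
      tendsto_one_div_add_atTop_nhds_zero_nat
  obtain ⟨w, hw, φ, hφ, hlim⟩ := (isCompact_sphere (0 : E) 1).tendsto_subseq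
    (x := fun n => ‖d n‖⁻¹ • d n) (fun n => by simp [norm_smul, hd0 n])
  refine ⟨w, fun h => by simp [h] at hw, fun r => ?_⟩
  have hdφ := hd.comp hφ.tendsto_atTop
  have hfloor : Tendsto (fun n => (⌊r / ‖d (φ n)‖⌋ : ℝ) * ‖d (φ n)‖) atTop (𝓝 r) := by
    rw [tendsto_iff_norm_sub_tendsto_zero]
    refine squeeze_zero (fun n => norm_nonneg _) (fun n => ?_) hdφ
    have hpos : 0 < ‖d (φ n)‖ := norm_pos_iff.mpr (hd0 _)
    have h1 := (le_div_iff₀ hpos).mp (Int.floor_le (r / ‖d (φ n)‖))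
    have h2 := (div_lt_iff₀ hpos).mp (Int.lt_floor_add_one (r / ‖d (φ n)‖))
    rw [Real.norm_eq_abs, abs_le, Function.comp_apply]
    constructor <;> linarith
  refine hT.mem_of_tendsto (hfloor.smul hlim) (Eventually.of_forall fun n => ?_)
  have hne : ‖d (φ n)‖ ≠ 0 := norm_ne_zero_iff.mpr (hd0 _)
  simp only [Function.comp_apply, smul_smul, mul_assoc, mul_inv_cancel₀ hne, mul_one]
  rw [Int.cast_smul_eq_zsmul]
  exact T.zsmul_mem (hdT _) _

/-- A closed uncountable subgroup of `ℝ` is everything. -/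
theorem AddSubgroup.eq_top_of_isClosed_of_not_countable (D : AddSubgroup ℝ)
    (hD : IsClosed (D : Set ℝ)) (hu : ¬ (D : Set ℝ).Countable) : D = ⊤ := by
  obtain ⟨w, hw, h⟩ := D.exists_line_of_isClosed_of_not_countable hD hu
  refine (AddSubgroup.eq_top_iff' D).mpr fun x => ?_
  simpa [hw] using h (x / w)

/-- A continuous homomorphism from `(ℝ, +)` to the multiplicative monoid `ℝ` is exponential. -/
theorem Real.exists_eq_exp_mul_of_continuous {h : ℝ → ℝ} (hc : Continuous h) (h0 : h 0 = 1)
    (hadd : ∀ r s, h (r + s) = h r * h s) : ∃ k : ℝ, ∀ r, h r = Real.exp (k * r) := by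
  have hne : ∀ r, h r ≠ 0 := fun r hr => by
    have := hadd r (-r)
    simp [hr, h0] at this
  have hpos : ∀ r, 0 < h r := fun r => by
    have := hadd (r / 2) (r / 2)
    rw [add_halves] at this
    rw [this]
    exact mul_self_pos.mpr (hne _)
  let L : ℝ →+ ℝ :=
    { toFun := fun r => Real.log (h r)
      map_zero' := by simp [h0]
      map_add' := fun r s => by rw [hadd, Real.log_mul (hne r) (hne s)] }
  have hL : Continuous L := hc.log hne
  refine ⟨L 1, fun r => ?_⟩
  have := map_real_smul L hL r 1
  simp only [smul_eq_mul, mul_one] at this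
  rw [mul_comm, ← this]
  exact (Real.exp_log (hpos r)).symm

section ScalingGroup

variable {E : Type*} [NormedAddCommGroup E]

/-- The factor by which translation by `t` scales the difference of the values at `p` and `q`. -/
noncomputable def scalingFactor (f : E → ℝ) (p q t : E) : ℝ :=
  (f (p + t) - f (q + t)) / (f p - f q)

theorem continuous_scalingFactor {f : E → ℝ} (hf : Continuous f) (p q : E) :
    Continuous (scalingFactor f p q) := by
  unfold scalingFactor
  fun_prop

theorem scalingFactor_eq {f : E → ℝ} {p q t : E} {c : ℝ} (hpq : f p ≠ f q)
    (h : ∀ x y, f (x + t) - f (y + t) = c * (f x - f y)) : scalingFactor f p q t = c := by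
  rw [scalingFactor, h, mul_div_cancel_right₀ _ (sub_ne_zero.mpr hpq)]

/-- The translations under which all differences of values of `f` scale by a common factor. -/
noncomputable def scalingGroup (f : E → ℝ) (p q : E) (hpq : f p ≠ f q) : AddSubgroup E where
  carrier := {t | ∀ x y, f (x + t) - f (y + t) = scalingFactor f p q t * (f x - f y)}
  zero_mem' x y := by
    simp [scalingFactor, div_self (sub_ne_zero.mpr hpq)]
  add_mem' {s t} hs ht := by
    have h : ∀ x y, f (x + (s + t)) - f (y + (s + t)) =
        scalingFactor f p q t * scalingFactor f p q s * (f x - f y) := fun x y => by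
      rw [← add_assoc, ← add_assoc, ht, hs, mul_assoc]
    intro x y
    rw [scalingFactor_eq hpq h, h]
  neg_mem' {t} ht := by
    have hne : scalingFactor f p q t ≠ 0 := fun h0 => hpq <| sub_eq_zero.mp <| by
      simpa [h0] using ht (p - t) (q - t)
    have h : ∀ x y, f (x + -t) - f (y + -t) = (scalingFactor f p q t)⁻¹ * (f x - f y) :=
      fun x y => by
        have := ht (x + -t) (y + -t)
        simp only [neg_add_cancel_right] at this
        rw [this, inv_mul_cancel_left₀ hne]
    intro x y
    rw [scalingFactor_eq hpq h, h]

variable {f : E → ℝ} {p q : E} {hpq : f p ≠ f q}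

theorem mem_scalingGroup {t : E} : t ∈ scalingGroup f p q hpq ↔
    ∀ x y, f (x + t) - f (y + t) = scalingFactor f p q t * (f x - f y) := Iff.rfl

theorem isClosed_scalingGroup (hf : Continuous f) :
    IsClosed (scalingGroup f p q hpq : Set E) := by
  have := continuous_scalingFactor hf p q
  have h : (scalingGroup f p q hpq : Set E) =
      ⋂ x, ⋂ y, {t | f (x + t) - f (y + t) = scalingFactor f p q t * (f x - f y)} := by
    ext t
    simp [mem_scalingGroup]
  rw [h]
  exact isClosed_iInter fun x => isClosed_iInter fun y =>
    isClosed_eq (by fun_prop) (by fun_prop)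

theorem scalingFactor_add {s t : E} (hs : s ∈ scalingGroup f p q hpq)
    (ht : t ∈ scalingGroup f p q hpq) :
    scalingFactor f p q (s + t) = scalingFactor f p q s * scalingFactor f p q t :=
  scalingFactor_eq hpq fun x y => by
    rw [← add_assoc, ← add_assoc, mem_scalingGroup.mp ht, mem_scalingGroup.mp hs]
    ring

/-- If a line consists of scaling translations, not all with factor one, then `f` is
an exponential plus a constant along all its translates, with the same constant. -/
theorem exists_eq_add_mul_exp [NormedSpace ℝ E] (hf : Continuous f) {w : E}
    (hw : ∀ r : ℝ, r • w ∈ scalingGroup f p q hpq)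
    (hne : ∃ r : ℝ, scalingFactor f p q (r • w) ≠ 1) :
    ∃ a k : ℝ, k ≠ 0 ∧ ∀ (x : E) (r : ℝ), f (x + r • w) = a + (f x - a) * Real.exp (k * r) := by
  obtain ⟨k, hk⟩ := Real.exists_eq_exp_mul_of_continuous (h := fun r => scalingFactor f p q (r • w))
    ((continuous_scalingFactor hf p q).comp (by fun_prop))
    (by simp [scalingFactor, div_self (sub_ne_zero.mpr hpq)])
    (fun r s => by simp only [add_smul]; exact scalingFactor_add (hw r) (hw s))
  have hk0 : k ≠ 0 := by
    rintro rfl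
    obtain ⟨r, hr⟩ := hne
    exact hr (by simpa using hk r)
  have hscale : ∀ (r : ℝ) (x y : E),
      f (x + r • w) - f (y + r • w) = Real.exp (k * r) * (f x - f y) := fun r x y => by
    rw [← hk r]
    exact mem_scalingGroup.mp (hw r) x y
  have hek : 1 - Real.exp k ≠ 0 := sub_ne_zero.mpr fun h => hk0 (by simpa using h.symm)
  refine ⟨f 0 + (f (0 + (1 : ℝ) • w) - f 0) / (1 - Real.exp k), k, hk0, fun x r => ?_⟩
  have h1 := hscale r x (x + (1 : ℝ) • w)
  have h2 := hscale 1 x (x + r • w)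
  have h3 := hscale 1 x 0
  rw [add_right_comm] at h1
  simp only [mul_one] at h2 h3
  field_simp
  linear_combination h1 - h2 + (1 - Real.exp (k * r)) * h3

end ScalingGroup

theorem exists_unit_smul_eq {w : ℝ × ℝ} (hw : w ≠ 0) :
    ∃ ρ θ : ℝ, ρ • w = (Real.cos θ, Real.sin θ) := by
  have hz : (⟨w.1, w.2⟩ : ℂ) ≠ 0 := fun h => hw <| by
    rw [Complex.ext_iff] at h
    exact Prod.ext h.1 h.2
  refine ⟨‖(⟨w.1, w.2⟩ : ℂ)‖⁻¹, Complex.arg ⟨w.1, w.2⟩, ?_⟩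
  rw [Complex.cos_arg hz, Complex.sin_arg]
  ext <;> simp [div_eq_inv_mul]

theorem exists_rotation_of_line {f : ℝ × ℝ → ℝ} (hf : Continuous f) {p q : ℝ × ℝ}
    {hpq : f p ≠ f q} {θ : ℝ}
    (hw : ∀ r : ℝ, r • (Real.cos θ, Real.sin θ) ∈ scalingGroup f p q hpq)
    (hne : ∃ r : ℝ, scalingFactor f p q (r • (Real.cos θ, Real.sin θ)) ≠ 1) :
    ∃ (θ a k : ℝ) (s : ℝ → ℝ), k ≠ 0 ∧ Continuous s ∧ ∀ x y : ℝ,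
        f (Real.cos θ * x - Real.sin θ * y, Real.sin θ * x + Real.cos θ * y)
          = a + s y * Real.exp (k * x) := by
  obtain ⟨a, k, hk, h⟩ := exists_eq_add_mul_exp hf hw hne
  refine ⟨θ, a, k, fun y => f (-Real.sin θ * y, Real.cos θ * y) - a, hk, by fun_prop,
    fun x y => ?_⟩
  rw [← h]
  congr 1
  ext <;> simp <;> ring

/-- for uncountable C ⊆ (0,∞), a continuous f : ℝ² → ℝ is vertically rigid
for C via translations iff after a suitable rotation around the z-axis it is of the form
(x,y) ↦ a + s(y)·e^{kx}. -/
theorem stmt8 (C : Set ℝ) (hC : C ⊆ Set.Ioi 0) (hCu : ¬ C.Countable)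
    (f : ℝ × ℝ → ℝ) (hf : Continuous f) :
    (∀ c ∈ C, ∃ (t : ℝ × ℝ) (u : ℝ), ∀ x : ℝ × ℝ, f (x + t) + u = c * f x) ↔
    (∃ (θ a k : ℝ) (s : ℝ → ℝ), k ≠ 0 ∧ Continuous s ∧ ∀ x y : ℝ,
        f (Real.cos θ * x - Real.sin θ * y, Real.sin θ * x + Real.cos θ * y)
          = a + s y * Real.exp (k * x)) := by
  constructor
  · intro h
    by_cases hconst : ∀ p q, f p = f q
    · exact ⟨0, f 0, 1, 0, one_ne_zero, continuous_const, fun x y => by simp [hconst _ 0]⟩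
    push Not at hconst
    obtain ⟨p, q, hpq⟩ := hconst
    set T := scalingGroup f p q hpq
    have hCT : C ⊆ scalingFactor f p q '' T := by
      intro c hc
      obtain ⟨t, u, htu⟩ := h c hc
      have hd : ∀ x y, f (x + t) - f (y + t) = c * (f x - f y) := fun x y => by
        linear_combination htu x - htu y
      have hct := scalingFactor_eq hpq hd
      exact ⟨t, mem_scalingGroup.mpr (by rwa [hct]), hct⟩
    have hTc : IsClosed (T : Set (ℝ × ℝ)) := isClosed_scalingGroup hf
    obtain ⟨w, hw0, hw⟩ := T.exists_line_of_isClosed_of_not_countable hTc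
      fun hcount => hCu ((hcount.image _).mono hCT)
    obtain ⟨ρ, θ, hθ⟩ := exists_unit_smul_eq hw0
    replace hw : ∀ r : ℝ, r • (Real.cos θ, Real.sin θ) ∈ T := fun r => by
      rw [← hθ, smul_smul]
      exact hw _
    by_cases hne : ∃ r : ℝ, scalingFactor f p q (r • (Real.cos θ, Real.sin θ)) ≠ 1
    · exact exists_rotation_of_line hf hw hne
    push Not at hne
    let v : ℝ × ℝ := (Real.cos (θ + π / 2), Real.sin (θ + π / 2))
    let D : AddSubgroup ℝ := T.comap (LinearMap.toSpanSingleton ℝ (ℝ × ℝ) v).toAddMonoidHom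
    have hDmem : ∀ r, r ∈ D ↔ r • v ∈ T := fun r => Iff.rfl
    have hDc : IsClosed (D : Set ℝ) :=
      hTc.preimage (show Continuous fun r : ℝ => r • v by fun_prop)
    have hCD : C ⊆ (fun r : ℝ => scalingFactor f p q (r • v)) '' D := by
      intro c hc
      obtain ⟨t, ht, rfl⟩ := hCT hc
      set α := Real.cos θ * t.1 + Real.sin θ * t.2
      set β := -Real.sin θ * t.1 + Real.cos θ * t.2
      have ht' : t = α • (Real.cos θ, Real.sin θ) + β • v := by
        have := Real.sin_sq_add_cos_sq θ
        ext
        · simp [v, α, β, Real.cos_add_pi_div_two]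
          linear_combination -t.1 * this
        · simp [v, α, β, Real.sin_add_pi_div_two]
          linear_combination -t.2 * this
      have hβ : β • v ∈ T := by
        rw [eq_sub_of_add_eq' ht'.symm]
        exact T.sub_mem ht (hw α)
      refine ⟨β, (hDmem β).mpr hβ, ?_⟩
      change scalingFactor f p q (β • v) = _
      rw [ht', scalingFactor_add (hw α) hβ, hne, one_mul]
    have hDtop : D = ⊤ := D.eq_top_of_isClosed_of_not_countable hDc
      fun hcount => hCu ((hcount.image _).mono hCD)
    refine exists_rotation_of_line hf (θ := θ + π / 2) (hpq := hpq)
      (fun r => (hDmem r).mp (hDtop ▸ AddSubgroup.mem_top r)) ?_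
    by_contra! hone
    refine hCu ((countable_singleton (1 : ℝ)).mono fun c hc => ?_)
    obtain ⟨r, -, rfl⟩ := hCD hc
    exact hone r
  · rintro ⟨θ, a, k, s, hk, -, h⟩ c hc
    have hc0 : 0 < c := hC hc
    refine ⟨(Real.cos θ * (Real.log c / k), Real.sin θ * (Real.log c / k)), c * a - a,
      fun z => ?_⟩
    have hsc := Real.sin_sq_add_cos_sq θ
    have h1 := h (Real.cos θ * z.1 + Real.sin θ * z.2) (-Real.sin θ * z.1 + Real.cos θ * z.2)
    have h2 := h (Real.cos θ * z.1 + Real.sin θ * z.2 + Real.log c / k)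
      (-Real.sin θ * z.1 + Real.cos θ * z.2)
    rw [mul_add k, mul_div_cancel₀ _ hk, Real.exp_add, Real.exp_log hc0] at h2
    have e1 : z = (Real.cos θ * (Real.cos θ * z.1 + Real.sin θ * z.2)
          - Real.sin θ * (-Real.sin θ * z.1 + Real.cos θ * z.2),
        Real.sin θ * (Real.cos θ * z.1 + Real.sin θ * z.2)
          + Real.cos θ * (-Real.sin θ * z.1 + Real.cos θ * z.2)) := by
      ext
      · linear_combination -z.1 * hsc
      · linear_combination -z.2 * hsc
    rw [← e1] at h1
    have e2 : z + (Real.cos θ * (Real.log c / k), Real.sin θ * (Real.log c / k)) =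
        (Real.cos θ * (Real.cos θ * z.1 + Real.sin θ * z.2 + Real.log c / k)
          - Real.sin θ * (-Real.sin θ * z.1 + Real.cos θ * z.2),
        Real.sin θ * (Real.cos θ * z.1 + Real.sin θ * z.2 + Real.log c / k)
          + Real.cos θ * (-Real.sin θ * z.1 + Real.cos θ * z.2)) := by
      ext
      · simp only [Prod.fst_add]
        linear_combination -z.1 * hsc
      · simp only [Prod.snd_add]
        linear_combination -z.2 * hsc
    rw [← e2] at h2
    linear_combination h2 - c * h1
end
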